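/- arXiv:1909.11530 — 3 statements merged into one kernel-verified Lean document; each statement's English description precedes it below -/
import Mathlib

section
/- Let (X,d) be a complete and connected metric space with 0 < ℋ¹(X) < ∞. Every function v : X → ℝ with pV(v,X) < ∞ is bounded. -/
open MeasureTheory Set Filter Topology ENNReal

/-- A rectifiable curve parametrized by arc length: a map defined (in effect) on `[0, len]`
whose variation on every subinterval `[s,t] ⊆ [0,len]` equals `t - s`. -/
structure MCurve (X : Type*) [MetricSpace X] where
  len : ℝ
  len_nonneg : 0 ≤ len
  toFun : ℝ → X
  arclength : ∀ s t : ℝ, s ∈ Set.Icc 0 len → t ∈ Set.Icc 0 len → s ≤ t →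
    eVariationOn toFun (Set.Icc s t) = ENNReal.ofReal (t - s)

namespace MCurve

variable {X : Type*} [MetricSpace X]

/-- The image of a curve. -/
def image (γ : MCurve X) : Set X := γ.toFun '' Set.Icc 0 γ.len

/-- A curve is simple (injective) if its parametrization is injective on `[0, len]`. -/
def IsSimple (γ : MCurve X) : Prop := Set.InjOn γ.toFun (Set.Icc 0 γ.len)

end MCurve

/-- Pointwise variation `pV(v, X)`: supremum over finite collections of pairwise disjoint
injective arc-length parametrized curves of the sums of endpoint differences. -/
noncomputable def pVar {X : Type*} [MetricSpace X] (v : X → ℝ) : ℝ≥0∞ :=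
  ⨆ (n : ℕ) (γ : Fin n → MCurve X) (_ : ∀ i, (γ i).IsSimple)
    (_ : ∀ i j, i ≠ j → Disjoint (γ i).image (γ j).image),
    ∑ i, ENNReal.ofReal |v ((γ i).toFun (γ i).len) - v ((γ i).toFun 0)|

/-- Pointwise variation `pV_D(v, X)` with curve endpoints restricted to lie in `D`. -/
noncomputable def pVarOn {X : Type*} [MetricSpace X] (D : Set X) (v : X → ℝ) : ℝ≥0∞ :=
  ⨆ (n : ℕ) (γ : Fin n → MCurve X) (_ : ∀ i, (γ i).IsSimple)
    (_ : ∀ i j, i ≠ j → Disjoint (γ i).image (γ j).image)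
    (_ : ∀ i, (γ i).toFun 0 ∈ D ∧ (γ i).toFun (γ i).len ∈ D),
    ∑ i, ENNReal.ofReal |v ((γ i).toFun (γ i).len) - v ((γ i).toFun 0)|

/-- `Var(u, X)`: infimum of `pV(v, X)` over representatives `v = u` a.e. -/
noncomputable def VarH {X : Type*} [MetricSpace X] [MeasurableSpace X]
    (μ : Measure X) (u : X → ℝ) : ℝ≥0∞ :=
  ⨅ (v : X → ℝ) (_ : v =ᵐ[μ] u), pVar v

/-- `g` is an upper gradient of `u`: `g` is Borel and the upper gradient inequality holds
along every arc-length parametrized rectifiable curve. -/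
def IsUpperGradient {X : Type*} [MetricSpace X] [MeasurableSpace X]
    (u : X → ℝ) (g : X → ℝ≥0∞) : Prop :=
  Measurable g ∧ ∀ γ : MCurve X,
    ENNReal.ofReal |u (γ.toFun γ.len) - u (γ.toFun 0)| ≤ ∫⁻ s in Set.Icc 0 γ.len, g (γ.toFun s)

/-- The total variation `‖Du‖(X)`: infimum of `liminf ∫ gᵢ dμ` over sequences `uᵢ → u` in
`L¹(X, μ)` with upper gradients `gᵢ`. -/
noncomputable def totalVarH {X : Type*} [MetricSpace X] [MeasurableSpace X]
    (μ : Measure X) (u : X → ℝ) : ℝ≥0∞ :=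
  ⨅ (ui : ℕ → X → ℝ) (gi : ℕ → X → ℝ≥0∞) (_ : ∀ i, IsUpperGradient (ui i) (gi i))
    (_ : Filter.Tendsto (fun i => ∫⁻ x, ENNReal.ofReal |ui i x - u x| ∂μ)
      Filter.atTop (nhds 0)),
    Filter.atTop.liminf (fun i => ∫⁻ x, gi i x ∂μ)

namespace S10

variable {X : Type*} [MetricSpace X]

lemma ball_lower [ConnectedSpace X] [MeasurableSpace X] [BorelSpace X]
    (x z : X) (r : ℝ) (hz : r ≤ dist z x) :
    ENNReal.ofReal r ≤ μH[1] (Metric.ball x r) := by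
  have hl : LipschitzWith 1 (fun w : X => dist w x) := LipschitzWith.dist_left x
  have h1 := hl.hausdorffMeasure_image_le (d := 1) zero_le_one (Metric.ball x r)
  have hsub : Set.Ico 0 r ⊆ (fun w : X => dist w x) '' Metric.ball x r := by
    intro t ht
    have hc : IsPreconnected (Set.range (fun w : X => dist w x)) :=
      isPreconnected_range hl.continuous
    have : t ∈ Set.range (fun w : X => dist w x) :=
      hc.Icc_subset ⟨x, dist_self x⟩ ⟨z, rfl⟩ ⟨ht.1, ht.2.le.trans hz⟩
    obtain ⟨w, hw⟩ := this
    refine ⟨w, ?_, hw⟩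
    rw [Metric.mem_ball]
    simp only at hw
    rw [hw]; exact ht.2
  have h2 := measure_mono (μ := (μH[1] : Measure ℝ)) hsub
  rw [hausdorffMeasure_real] at h2 h1
  simp at h1 h2
  exact h2.trans h1

lemma compact [CompleteSpace X] [ConnectedSpace X] [MeasurableSpace X] [BorelSpace X]
    (h1 : μH[1] (Set.univ : Set X) < ⊤) : CompactSpace X := by
  rw [← isCompact_univ_iff, isCompact_iff_totallyBounded_isComplete]
  refine ⟨?_, isComplete_univ⟩
  rw [Metric.totallyBounded_iff]
  intro ε hε
  by_contra hcon
  have hstep : ∀ s : Finset X, (∀ x ∈ s, True) → ∃ y : X, True ∧ ∀ x ∈ s, ε ≤ dist y x := by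
    intro s _
    by_contra h
    push Not at h
    apply hcon
    refine ⟨s, s.finite_toSet, ?_⟩
    intro y _
    obtain ⟨x, hx, hd⟩ := h y trivial
    simp only [Set.mem_iUnion]
    exact ⟨x, hx, hd⟩
  obtain ⟨f, -, hf⟩ := exists_seq_of_forall_finset_exists _ _ hstep
  have hf' : ∀ m n, m ≠ n → ε ≤ dist (f m) (f n) := by
    intro m n hmn
    rcases lt_or_gt_of_ne hmn with h | h
    · rw [dist_comm]; exact hf m n h
    · exact hf n m h
  have hfin := Measure.finite_const_le_meas_of_disjoint_iUnion (μH[1] : Measure X)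
    (ε := ENNReal.ofReal (ε/2)) (by simpa using hε) (As := fun n => Metric.ball (f n) (ε/2))
    (fun i => Metric.isOpen_ball.measurableSet)
    (fun i j hij => Metric.ball_disjoint_ball (by linarith [hf' i j hij]))
    (ne_top_of_le_ne_top h1.ne (measure_mono (subset_univ _)))
  have : {i : ℕ | ENNReal.ofReal (ε/2) ≤ μH[1] (Metric.ball (f i) (ε/2))} = Set.univ := by
    ext i
    simp only [Set.mem_setOf_eq, Set.mem_univ, iff_true]
    apply ball_lower _ (f (i+1))
    linarith [hf' (i+1) i (by omega)]
  rw [this] at hfin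
  exact Set.infinite_univ hfin

lemma limit [CompactSpace X] (x y : X) (L : ℝ) (hL : 0 ≤ L)
    (h : ∀ η > 0, ∃ h : ℝ → X, h 0 = x ∧ dist (h L) y ≤ η ∧
      ∀ s ∈ Icc 0 L, ∀ t ∈ Icc 0 L, dist (h s) (h t) ≤ |s - t| + η) :
    ∃ g : ℝ → X, g 0 = x ∧ g L = y ∧ LipschitzOnWith 1 g (Icc 0 L) := by
  choose! H H0 H1 H2 using h
  have hη : ∀ n : ℕ, (0:ℝ) < 1 / ((n:ℝ) + 1) := fun n => Nat.one_div_pos_of_nat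
  set F : ℕ → ℝ → X := fun n => H (1 / ((n:ℝ)+1)) (hη n) with hF
  have hlim : Tendsto (fun n : ℕ => 1 / ((n:ℝ)+1)) (hyperfilter ℕ) (𝓝 0) :=
    (tendsto_one_div_add_atTop_nhds_zero_nat (𝕜 := ℝ)).mono_left
      (by rw [← Nat.cofinite_eq_atTop]; exact hyperfilter_le_cofinite)
  have hex : ∀ t : ℝ, ∃ z : X, Tendsto (fun n => F n t) (hyperfilter ℕ) (𝓝 z) := by
    intro t
    exact ⟨_, ((hyperfilter ℕ).map (fun n => F n t)).le_nhds_lim⟩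
  choose g hg using hex
  refine ⟨g, ?_, ?_, ?_⟩
  · refine tendsto_nhds_unique (hg 0) ?_
    have : (fun n => F n 0) = fun _ => x := by
      funext n; exact H0 _ (hη n)
    rw [this]; exact tendsto_const_nhds
  · have h1 : dist (g L) y ≤ 0 :=
      le_of_tendsto_of_tendsto' ((hg L).dist tendsto_const_nhds) hlim (fun n => H1 _ (hη n))
    exact dist_le_zero.1 h1
  · apply LipschitzOnWith.of_dist_le_mul
    intro s hs t ht
    have h1 : dist (g s) (g t) ≤ |s - t| + 0 :=
      le_of_tendsto_of_tendsto' ((hg s).dist (hg t)) (tendsto_const_nhds.add hlim)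
        (fun n => H2 _ (hη n) s hs t ht)
    simpa [Real.dist_eq] using h1

lemma chain [ConnectedSpace X] (x y : X) (ε : ℝ) (hε : 0 < ε) :
    ∃ (N : ℕ) (p : ℕ → X) (D : X → ℕ), p 0 = x ∧ (∀ i, N ≤ i → p i = y) ∧
      (∀ i, dist (p i) (p (i+1)) < ε) ∧ D x = 0 ∧ D y = N ∧
      ∀ a b, dist a b < ε → D b ≤ D a + 1 := by
  let G : SimpleGraph X :=
    { Adj := fun a b => a ≠ b ∧ dist a b < ε
      symm := ⟨fun a b h => ⟨h.1.symm, by rw [dist_comm]; exact h.2⟩⟩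
      loopless := ⟨fun a h => h.1 rfl⟩ }
  have hreach : ∀ a b : X, dist a b < ε → G.Reachable a b := by
    intro a b h
    by_cases hab : a = b
    · subst hab; exact SimpleGraph.Reachable.refl _
    · exact SimpleGraph.Adj.reachable (show G.Adj a b from ⟨hab, h⟩)
  have hclopen : IsClopen {b | G.Reachable x b} := by
    constructor
    · rw [← isOpen_compl_iff, Metric.isOpen_iff]
      intro b hb
      refine ⟨ε, hε, fun c hc hxc => hb ?_⟩
      exact SimpleGraph.Reachable.trans hxc (hreach c b hc)
    · rw [Metric.isOpen_iff]
      intro b hb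
      refine ⟨ε, hε, fun c hc => ?_⟩
      exact SimpleGraph.Reachable.trans hb (hreach c b hc).symm
  have huniv := hclopen.eq_univ ⟨x, SimpleGraph.Reachable.refl _⟩
  have hx : ∀ b, G.Reachable x b := fun b => by
    have : b ∈ {b | G.Reachable x b} := by rw [huniv]; trivial
    exact this
  obtain ⟨w, hw⟩ := (hx y).exists_walk_length_eq_dist
  refine ⟨w.length, w.getVert, G.dist x, w.getVert_zero, fun i hi => w.getVert_of_length_le hi,
    ?_, by simp, hw.symm, ?_⟩
  · intro i
    rcases lt_or_ge i w.length with h | h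
    · exact (w.adj_getVert_succ h).2
    · rw [w.getVert_of_length_le h, w.getVert_of_length_le (by omega), dist_self]; exact hε
  · intro a b hab
    by_cases h : a = b
    · subst h; omega
    · have h1 := (hx a).dist_triangle_left b
      have h2 : G.dist a b = 1 := SimpleGraph.dist_eq_one_iff_adj.2 ⟨h, hab⟩
      omega

lemma chain_bound [ConnectedSpace X] [MeasurableSpace X] [BorelSpace X]
    (h1 : μH[1] (Set.univ : Set X) < ⊤) (x y : X) (ε : ℝ) (hε : 0 < ε) (hxy : ε ≤ dist x y) :
    ∃ (N : ℕ) (p : ℕ → X), p 0 = x ∧ (∀ i, N ≤ i → p i = y) ∧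
      (∀ i, dist (p i) (p (i+1)) < ε) ∧ N * ε ≤ 4 * (μH[1] (Set.univ : Set X)).toReal := by
  obtain ⟨N, p, D, p0, pN, hp, Dx, Dy, hD⟩ := chain x y ε hε
  refine ⟨N, p, p0, pN, hp, ?_⟩
  have hk : ∀ i k, D (p (i+k)) ≤ D (p i) + k := by
    intro i k
    induction k with
    | zero => simp
    | succ k ih => have := hD _ _ (hp (i+k)); rw [← add_assoc]; omega
  have hDi : ∀ i ≤ N, D (p i) = i := by
    intro i hi
    have a := hk 0 i
    rw [p0, Dx] at a
    have b := hk i (N - i)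
    rw [pN (i + (N-i)) (by omega), Dy] at b
    simp at a
    omega
  have hsep : ∀ i j, i + 2 ≤ j → j ≤ N → ε ≤ dist (p i) (p j) := by
    intro i j hij hj
    by_contra h
    push Not at h
    have := hD _ _ h
    rw [hDi i (by omega), hDi j hj] at this
    omega
  have hsep2 : ∀ k ∈ Finset.range (N/2+1), ∀ l ∈ Finset.range (N/2+1), k ≠ l →
      ε ≤ dist (p (2*k)) (p (2*l)) := by
    intro k hk l hl hkl
    simp only [Finset.mem_range] at hk hl
    rcases lt_or_gt_of_ne hkl with h | h
    · exact hsep _ _ (by omega) (by omega)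
    · rw [dist_comm]; exact hsep _ _ (by omega) (by omega)
  have hsum := sum_measure_le_measure_univ (μ := (μH[1] : Measure X))
    (s := Finset.range (N/2+1)) (t := fun k => Metric.ball (p (2*k)) (ε/2))
    (fun i _ => Metric.isOpen_ball.measurableSet.nullMeasurableSet)
    (fun k hk l hl hkl => (Metric.ball_disjoint_ball
      (by linarith [hsep2 k hk l hl hkl])).aedisjoint)
  have hlow : ∀ k, ENNReal.ofReal (ε/2) ≤ μH[1] (Metric.ball (p (2*k)) (ε/2)) := by
    intro k
    rcases le_or_gt (ε/2) (dist x (p (2*k))) with h | h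
    · exact ball_lower _ x _ h
    · apply ball_lower _ y
      have := dist_triangle_right x y (p (2*k))
      linarith
  have h2 : ∑ k ∈ Finset.range (N/2+1), ENNReal.ofReal (ε/2) ≤ μH[1] (Set.univ : Set X) :=
    (Finset.sum_le_sum (fun k _ => hlow k)).trans hsum
  rw [← ENNReal.ofReal_sum_of_nonneg (fun _ _ => by positivity),
    ENNReal.ofReal_le_iff_le_toReal h1.ne] at h2
  simp only [Finset.sum_const, Finset.card_range, nsmul_eq_mul] at h2
  have h3 : (N:ℝ) ≤ 2 * ((N/2+1 : ℕ):ℝ) := by exact_mod_cast (by omega)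
  nlinarith

lemma exists_lip [CompactSpace X] [ConnectedSpace X] [MeasurableSpace X] [BorelSpace X]
    (h1 : μH[1] (Set.univ : Set X) < ⊤) (x y : X) (hxy : x ≠ y) :
    ∃ L : ℝ, 0 ≤ L ∧ ∃ g : ℝ → X, g 0 = x ∧ g L = y ∧ LipschitzOnWith 1 g (Icc 0 L) := by
  refine ⟨4 * (μH[1] (Set.univ : Set X)).toReal, by positivity, ?_⟩
  apply limit _ _ _ (by positivity)
  intro η hη
  have hd := dist_pos.2 hxy
  obtain ⟨N, p, p0, pN, hp, hN⟩ := chain_bound h1 x y (min η (dist x y)) (lt_min hη hd)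
    (min_le_right _ _)
  set ε := min η (dist x y) with hεd
  have hε : 0 < ε := lt_min hη hd
  have hεη : ε ≤ η := min_le_left _ _
  have hdist : ∀ i k, dist (p i) (p (i+k)) ≤ k * ε := by
    intro i k
    induction k with
    | zero => simp
    | succ k ih =>
      have := dist_triangle (p i) (p (i+k)) (p (i+k+1))
      have := hp (i+k)
      rw [← add_assoc]; push_cast; linarith
  refine ⟨fun t => p ⌊t/ε⌋₊, by simp [p0], ?_, ?_⟩
  · simp only
    rw [pN, dist_self]
    · exact hη.le
    · apply Nat.le_floor
      rwa [le_div_iff₀ hε]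
  · have key : ∀ s t : ℝ, 0 ≤ s → s ≤ t → dist (p ⌊s/ε⌋₊) (p ⌊t/ε⌋₊) ≤ (t - s) + η := by
      intro s t hs hst
      have hm : ⌊s/ε⌋₊ ≤ ⌊t/ε⌋₊ := Nat.floor_mono (by gcongr)
      obtain ⟨k, hk⟩ := Nat.exists_eq_add_of_le hm
      have h2 := hdist ⌊s/ε⌋₊ k
      rw [← hk] at h2
      have h3 : (⌊t/ε⌋₊:ℝ) ≤ t/ε := Nat.floor_le (div_nonneg (hs.trans hst) hε.le)
      have h4 := Nat.lt_floor_add_one (s/ε)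
      rw [hk] at h3
      push_cast at h3
      have h5 : (k:ℝ) ≤ (t - s)/ε + 1 := by rw [sub_div]; linarith
      have h6 : (k:ℝ) * ε ≤ ((t-s)/ε + 1) * ε := by gcongr
      have h7 : ((t-s)/ε + 1) * ε = (t - s) + ε := by field_simp
      linarith
    intro s hs t ht
    rcases le_total s t with h | h
    · rw [abs_sub_comm, abs_of_nonneg (sub_nonneg.2 h)]; exact key s t hs.1 h
    · rw [abs_of_nonneg (sub_nonneg.2 h), dist_comm]; exact key t s ht.1 h

lemma exists_min [CompactSpace X] (x y : X)
    (h : ∃ L : ℝ, 0 ≤ L ∧ ∃ g : ℝ → X, g 0 = x ∧ g L = y ∧ LipschitzOnWith 1 g (Icc 0 L)) :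
    ∃ L : ℝ, 0 ≤ L ∧ (∃ g : ℝ → X, g 0 = x ∧ g L = y ∧ LipschitzOnWith 1 g (Icc 0 L)) ∧
      ∀ L' : ℝ, 0 ≤ L' → ∀ g : ℝ → X, g 0 = x → g L' = y → LipschitzOnWith 1 g (Icc 0 L') →
        L ≤ L' := by
  set S : Set ℝ := {L : ℝ | 0 ≤ L ∧ ∃ g : ℝ → X, g 0 = x ∧ g L = y ∧
    LipschitzOnWith 1 g (Icc 0 L)} with hS
  have hne : S.Nonempty := h
  have hbdd : BddBelow S := ⟨0, fun L hL => hL.1⟩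
  have h0 : 0 ≤ sInf S := le_csInf hne (fun L hL => hL.1)
  refine ⟨sInf S, h0, ?_, fun L' hL' g a b c => csInf_le hbdd ⟨hL', g, a, b, c⟩⟩
  apply limit _ _ _ h0
  intro η hη
  obtain ⟨L, ⟨hL0, g, g0, gL, hg⟩, hLη⟩ := exists_lt_of_csInf_lt hne (lt_add_of_pos_right _ hη)
  have hle : sInf S ≤ L := csInf_le hbdd ⟨hL0, g, g0, gL, hg⟩
  refine ⟨g, g0, ?_, ?_⟩
  · have := hg.dist_le_mul _ ⟨h0, hle⟩ L ⟨hL0, le_rfl⟩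
    rw [gL, Real.dist_eq, abs_sub_comm, abs_of_nonneg (sub_nonneg.2 hle)] at this
    simp at this
    linarith
  · intro s hs t ht
    have := hg.dist_le_mul s ⟨hs.1, hs.2.trans hle⟩ t ⟨ht.1, ht.2.trans hle⟩
    rw [Real.dist_eq] at this
    simp at this
    linarith

lemma var_le {L : ℝ} {g : ℝ → X} (hg : LipschitzOnWith 1 g (Icc 0 L)) (s t : ℝ)
    (hs : 0 ≤ s) (hst : s ≤ t) (ht : t ≤ L) :
    eVariationOn g (Icc s t) ≤ ENNReal.ofReal (t - s) := by
  have h1 := hg.comp_eVariationOn_le (g := id) (s := Icc s t)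
    (fun u hu => ⟨hs.trans hu.1, hu.2.trans ht⟩)
  have h2 := (monotone_id (α := ℝ)).monotoneOn (Icc s t) |>.eVariationOn_le
    (a := s) (b := t) ⟨le_rfl, hst⟩ ⟨hst, le_rfl⟩
  rw [inter_self] at h2
  rw [ENNReal.coe_one, one_mul] at h1
  exact h1.trans h2

lemma var_total {L : ℝ} (hL : 0 ≤ L) {g : ℝ → X} (hg : LipschitzOnWith 1 g (Icc 0 L))
    (hmin : ∀ L' : ℝ, 0 ≤ L' → ∀ f : ℝ → X, f 0 = g 0 → f L' = g L →
      LipschitzOnWith 1 f (Icc 0 L') → L ≤ L') :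
    ENNReal.ofReal L ≤ eVariationOn g (Icc 0 L) := by
  have hbv : BoundedVariationOn g (Icc 0 L) :=
    ne_top_of_le_ne_top ENNReal.ofReal_ne_top (var_le hg 0 L le_rfl hL le_rfl)
  have hlbv := hbv.locallyBoundedVariationOn
  have m0 : (0:ℝ) ∈ Icc 0 L := ⟨le_rfl, hL⟩
  have mL : L ∈ Icc 0 L := ⟨hL, le_rfl⟩
  set φ := variationOnFromTo g (Icc 0 L) 0 with hφ
  have hφ0 : φ 0 = 0 := variationOnFromTo.self _ _ _
  have hφL : φ L = (eVariationOn g (Icc 0 L)).toReal := by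
    rw [hφ, variationOnFromTo.eq_of_le _ _ hL, inter_self]
  have hmono : MonotoneOn φ (Icc 0 L) := variationOnFromTo.monotoneOn hlbv m0
  have hcont : ContinuousOn φ (Icc 0 L) := by
    have : LipschitzOnWith 1 φ (Icc 0 L) := by
      apply LipschitzOnWith.of_le_add
      intro s hs t ht
      rcases le_total s t with h | h
      · exact (hmono hs ht h).trans (by linarith [dist_nonneg (x := s) (y := t)])
      · have h2 := variationOnFromTo.add hlbv m0 ht hs
        have h3 : variationOnFromTo g (Icc 0 L) t s ≤ s - t := by
          rw [variationOnFromTo.eq_of_le _ _ h]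
          apply ENNReal.toReal_le_of_le_ofReal (sub_nonneg.2 h)
          exact (eVariationOn.mono _ inter_subset_right).trans (var_le hg t s ht.1 h hs.2)
        rw [Real.dist_eq, abs_of_nonneg (sub_nonneg.2 h)]
        linarith
    exact this.continuousOn
  have hivt : Icc 0 (φ L) ⊆ φ '' Icc 0 L := by
    have := intermediate_value_Icc hL hcont
    rwa [hφ0] at this
  have hus := has_unit_speed_naturalParameterization g hlbv m0
  rw [← hφ] at hus
  have hLφ : L ≤ φ L := by
    apply hmin (φ L) (by rw [hφL]; positivity) (naturalParameterization g (Icc 0 L) 0)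
    · have := edist_naturalParameterization_eq_zero hlbv m0 m0
      rw [← hφ, hφ0] at this
      exact edist_eq_zero.1 this
    · exact edist_eq_zero.1 (edist_naturalParameterization_eq_zero hlbv m0 mL)
    · have key : ∀ s ∈ Icc 0 (φ L), ∀ t ∈ Icc 0 (φ L), s ≤ t →
          edist (naturalParameterization g (Icc 0 L) 0 s)
            (naturalParameterization g (Icc 0 L) 0 t) ≤ ENNReal.ofReal (t - s) := by
        intro s hs t ht hst
        have h2 := hus (hivt hs) (hivt ht)
        simp only [NNReal.coe_one, one_mul] at h2
        rw [← h2]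
        exact eVariationOn.edist_le _ ⟨hivt hs, le_rfl, hst⟩ ⟨hivt ht, hst, le_rfl⟩
      intro s hs t ht
      rw [ENNReal.coe_one, one_mul, edist_dist s t, Real.dist_eq]
      rcases le_total s t with h | h
      · rw [abs_sub_comm, abs_of_nonneg (sub_nonneg.2 h)]; exact key s hs t ht h
      · rw [abs_of_nonneg (sub_nonneg.2 h), edist_comm]; exact key t ht s hs h
  rw [hφL] at hLφ
  exact ENNReal.ofReal_le_of_le_toReal hLφ

lemma exists_arc [CompactSpace X] [ConnectedSpace X] [MeasurableSpace X] [BorelSpace X]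
    (h1 : μH[1] (Set.univ : Set X) < ⊤) (x y : X) (hxy : x ≠ y) :
    ∃ γ : MCurve X, γ.IsSimple ∧ γ.toFun 0 = x ∧ γ.toFun γ.len = y := by
  obtain ⟨L, hL, ⟨g, g0, gL, hg⟩, hmin⟩ := exists_min x y (exists_lip h1 x y hxy)
  have htot := var_total hL hg (by rw [g0, gL]; exact hmin)
  refine ⟨⟨L, hL, g, ?_⟩, ?_, g0, gL⟩
  · intro s t hs ht hst
    apply le_antisymm (var_le hg s t hs.1 hst ht.2)
    have e1 := eVariationOn.Icc_add_Icc g (s := univ) hs.1 hst (mem_univ s)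
    have e2 := eVariationOn.Icc_add_Icc g (s := univ) ht.1 ht.2 (mem_univ t)
    simp only [univ_inter] at e1 e2
    have a1 := var_le hg 0 s le_rfl hs.1 hs.2
    have a2 := var_le hg s t hs.1 hst ht.2
    have a3 := var_le hg t L ht.1 ht.2 le_rfl
    rw [← e2, ← e1] at htot
    rw [sub_zero] at a1
    have f2 : eVariationOn g (Icc s t) ≠ ⊤ := ne_top_of_le_ne_top ENNReal.ofReal_ne_top a2
    have h3 : ENNReal.ofReal L ≤ ENNReal.ofReal s + ENNReal.ofReal (eVariationOn g (Icc s t)).toReal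
        + ENNReal.ofReal (L - t) := by
      rw [ENNReal.ofReal_toReal f2]
      exact htot.trans (by gcongr)
    rw [← ENNReal.ofReal_add hs.1 ENNReal.toReal_nonneg,
      ← ENNReal.ofReal_add (add_nonneg hs.1 ENNReal.toReal_nonneg) (sub_nonneg.2 ht.2)] at h3
    have h4 := (ENNReal.ofReal_le_ofReal_iff (add_nonneg
      (add_nonneg hs.1 ENNReal.toReal_nonneg) (sub_nonneg.2 ht.2))).1 h3
    apply ENNReal.ofReal_le_of_le_toReal
    linarith
  · have key : ∀ s ∈ Icc 0 L, ∀ t ∈ Icc 0 L, s < t → g s ≠ g t := by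
      intro s hs t ht hst heq
      have := hmin (L - (t - s)) (by linarith [hs.1, ht.2])
        (fun u => if u ≤ s then g u else g (u + (t - s)))
        (by simp [hs.1, g0])
        (by
          split_ifs with h
          · have : t = L := by linarith [ht.2]
            have h' : L - (t - s) = s := by linarith
            rw [h', heq, this, gL]
          · rw [sub_add_cancel, gL])
        (by
          have cross : ∀ u ∈ Icc 0 (L - (t-s)), ∀ w ∈ Icc 0 (L - (t-s)), u ≤ s → s < w →
              dist (g u) (g (w + (t - s))) ≤ w - u := by
            intro u hu w hw hus hsw
            have b1 := hg.dist_le_mul u ⟨hu.1, hus.trans hs.2⟩ s hs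
            have b2 := hg.dist_le_mul t ht (w + (t-s)) ⟨by linarith [hw.1], by linarith [hw.2]⟩
            have b3 := dist_triangle (g u) (g s) (g (w + (t-s)))
            rw [Real.dist_eq, abs_sub_comm, abs_of_nonneg (sub_nonneg.2 hus)] at b1
            rw [Real.dist_eq, abs_sub_comm, abs_of_nonneg (by linarith)] at b2
            rw [← heq] at b2
            simp only [NNReal.coe_one, one_mul] at b1 b2
            linarith
          apply LipschitzOnWith.of_dist_le_mul
          intro u hu w hw
          simp only [NNReal.coe_one, one_mul]
          split_ifs with c1 c2 c2
          · simpa using hg.dist_le_mul u ⟨hu.1, c1.trans hs.2⟩ w ⟨hw.1, c2.trans hs.2⟩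
          · rw [Real.dist_eq u w, abs_sub_comm, abs_of_nonneg (by linarith)]
            exact cross u hu w hw c1 (not_le.1 c2)
          · rw [Real.dist_eq u w, abs_of_nonneg (by linarith), dist_comm]
            exact cross w hw u hu c2 (not_le.1 c1)
          · have := hg.dist_le_mul (u + (t-s)) ⟨by linarith [hu.1], by linarith [hu.2]⟩
              (w + (t-s)) ⟨by linarith [hw.1], by linarith [hw.2]⟩
            simpa using this)
      linarith
    intro s hs t ht heq
    by_contra hne
    rcases lt_or_gt_of_ne hne with h | h
    · exact key s hs t ht h heq
    · exact key t ht s hs h heq.symm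

end S10

theorem stmt10 {X : Type*} [MetricSpace X] [CompleteSpace X] [ConnectedSpace X]
    [MeasurableSpace X] [BorelSpace X]
    (h0 : 0 < μH[1] (Set.univ : Set X)) (h1 : μH[1] (Set.univ : Set X) < ⊤)
    (v : X → ℝ) (hv : pVar v < ⊤) :
    ∃ M : ℝ, ∀ x : X, |v x| ≤ M := by
  have := S10.compact h1
  obtain ⟨x0⟩ := (inferInstance : Nonempty X)
  refine ⟨|v x0| + (pVar v).toReal, fun y => ?_⟩
  by_cases hxy : x0 = y
  · subst hxy; linarith [ENNReal.toReal_nonneg (a := pVar v)]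
  obtain ⟨γ, hs, hγ0, hγ1⟩ := S10.exists_arc h1 x0 y hxy
  have hle : ENNReal.ofReal |v y - v x0| ≤ pVar v := by
    unfold pVar
    refine le_iSup_of_le 1 (le_iSup_of_le (fun _ => γ) (le_iSup_of_le (fun _ => hs)
      (le_iSup_of_le (fun i j hij => absurd (Subsingleton.elim i j) hij) ?_)))
    simp [hγ0, hγ1]
  rw [ENNReal.ofReal_le_iff_le_toReal hv.ne] at hle
  have := abs_sub_abs_le_abs_sub (v y) (v x0)
  linarith
end

section
/- Let (X,d) be a complete and connected metric space with 0 < ℋ¹(X) < ∞. Let v : X → ℝ be curve-continuous with pV(v,X) < ∞, and let t ∈ ℝ, r > 0. Then pV(v_t,X) + pV(v_{t,t+r},X) ≤ pV(v_{t+r},X), where v_t := min{t,v}, v_{t+r} := min{t+r,v} and v_{t,t+r} := max{t, min{t+r,v}}. -/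
open MeasureTheory Set Filter Topology ENNReal

/-- A function is curve-continuous if it is continuous along every curve in `X`. -/
def CurveContinuous {X : Type*} [MetricSpace X] (v : X → ℝ) : Prop :=
  ∀ γ : MCurve X, ContinuousOn (v ∘ γ.toFun) (Set.Icc 0 γ.len)


lemma aux_first {f : ℝ → ℝ} {L q : ℝ} (hL : 0 ≤ L) (hf : ContinuousOn f (Set.Icc 0 L))
    (h0 : f 0 < q) (h1 : q < f L) :
    ∃ s ∈ Set.Icc 0 L, f s = q ∧ ∀ x ∈ Set.Icc 0 s, f x ≤ q := by
  have hc : IsCompact (Set.Icc 0 L ∩ f ⁻¹' {q}) := by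
    apply IsCompact.of_isClosed_subset isCompact_Icc _ Set.inter_subset_left
    exact hf.preimage_isClosed_of_isClosed isClosed_Icc isClosed_singleton
  have hne : (Set.Icc 0 L ∩ f ⁻¹' {q}).Nonempty := by
    obtain ⟨s, hs, h⟩ := intermediate_value_Icc hL hf (show q ∈ Set.Icc (f 0) (f L) from ⟨h0.le, h1.le⟩)
    exact ⟨s, hs, h⟩
  obtain ⟨s, ⟨hs, hsq⟩, hmin⟩ := hc.exists_isLeast hne
  refine ⟨s, hs, hsq, fun x hx => ?_⟩
  by_contra! hlt
  obtain ⟨y, hy, h⟩ := intermediate_value_Icc hx.1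
    (hf.mono (Set.Icc_subset_Icc_right (hx.2.trans hs.2))) (show q ∈ Set.Icc (f 0) (f x) from ⟨h0.le, hlt.le⟩)
  have := hmin ⟨⟨hy.1, hy.2.trans (hx.2.trans hs.2)⟩, h⟩
  have hxs : x = s := le_antisymm hx.2 (this.trans hy.2)
  rw [hxs] at hlt
  exact absurd hsq (ne_of_gt hlt)

lemma aux_trim {f : ℝ → ℝ} {L t ε : ℝ} (hL : 0 ≤ L) (hf : ContinuousOn f (Set.Icc 0 L))
    (hε : 0 < ε) (hD : min t (f L) - min t (f 0) ≠ 0) :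
    ∃ a b, 0 ≤ a ∧ a ≤ b ∧ b ≤ L ∧ (∀ x ∈ Set.Icc a b, f x < t) ∧
      |min t (f L) - min t (f 0)| ≤ |f b - f a| + ε := by
  rcases lt_or_gt_of_ne (sub_ne_zero.1 hD) with h | h
  · have hLt : f L < t := by
      by_contra! h'
      rw [min_eq_left h'] at h
      exact absurd h (not_lt.2 (min_le_left _ _))
    rw [min_eq_right hLt.le] at h ⊢
    obtain ⟨q, hq1, hq2⟩ := exists_between (max_lt h (sub_lt_self (min t (f 0)) hε))
    have hq0 : f L < q := (le_max_left _ _).trans_lt hq1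
    have hqe := (le_max_right _ _).trans_lt hq1
    have hg : ContinuousOn (fun x => f (L - x)) (Set.Icc 0 L) := by
      apply hf.comp (by fun_prop)
      intro x hx
      exact ⟨by linarith [hx.2], by linarith [hx.1]⟩
    obtain ⟨s, hs, hsq, hle⟩ := aux_first (q := q) hL hg (by simpa using hq0)
      (by simpa using hq2.trans_le (min_le_right _ _))
    refine ⟨L - s, L, by linarith [hs.2], by linarith [hs.1], le_rfl, ?_, ?_⟩
    · intro x hx
      have := hle (L - x) ⟨by linarith [hx.2], by linarith [hx.1]⟩
      rw [show L - (L - x) = x by ring] at this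
      exact this.trans_lt (hq2.trans_le (min_le_left _ _))
    · rw [hsq, abs_of_neg (by linarith), abs_of_neg (by linarith)]
      linarith
  · have hLt : f 0 < t := by
      by_contra! h'
      rw [min_eq_left h'] at h
      exact absurd h (not_lt.2 (min_le_left _ _))
    rw [min_eq_right hLt.le] at h ⊢
    obtain ⟨q, hq1, hq2⟩ := exists_between (max_lt h (sub_lt_self (min t (f L)) hε))
    have hq0 : f 0 < q := (le_max_left _ _).trans_lt hq1
    have hqe := (le_max_right _ _).trans_lt hq1
    obtain ⟨s, hs, hsq, hle⟩ := aux_first (q := q) hL hf hq0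
      (hq2.trans_le (min_le_right _ _))
    refine ⟨0, s, le_rfl, hs.1, hs.2, ?_, ?_⟩
    · intro x hx
      exact (hle x hx).trans_lt (hq2.trans_le (min_le_left _ _))
    · rw [hsq, abs_of_pos (by linarith), abs_of_pos (by linarith)]
      linarith

/-- Restriction of a curve to a subinterval. -/
def MCurve.sub {X : Type*} [MetricSpace X] (γ : MCurve X) (a b : ℝ) (ha : 0 ≤ a) (hab : a ≤ b)
    (hb : b ≤ γ.len) : MCurve X where
  len := b - a
  len_nonneg := by linarith
  toFun := fun s => γ.toFun (s + a)
  arclength := by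
    intro s t hs ht hst
    have h := eVariationOn.comp_eq_of_monotoneOn γ.toFun (fun s : ℝ => s + a) (t := Set.Icc s t)
      (fun x _ y _ hxy => by simpa using hxy)
    have h2 := γ.arclength (s + a) (t + a) ⟨by linarith [hs.1], by linarith [hs.2]⟩
      ⟨by linarith [ht.1], by linarith [ht.2]⟩ (by linarith)
    rw [Set.image_add_const_Icc, h2] at h
    have e : t + a - (s + a) = t - s := by ring
    rw [e] at h
    exact h

lemma MCurve.sub_image {X : Type*} [MetricSpace X] (γ : MCurve X) (a b : ℝ) (ha : 0 ≤ a)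
    (hab : a ≤ b) (hb : b ≤ γ.len) :
    (γ.sub a b ha hab hb).image = γ.toFun '' Set.Icc a b := by
  have : (γ.sub a b ha hab hb).image = (γ.toFun ∘ (fun s => s + a)) '' Set.Icc 0 (b - a) := rfl
  rw [this, Set.image_comp, Set.image_add_const_Icc]
  simp

lemma MCurve.sub_simple {X : Type*} [MetricSpace X] (γ : MCurve X) (a b : ℝ) (ha : 0 ≤ a)
    (hab : a ≤ b) (hb : b ≤ γ.len) (h : γ.IsSimple) : (γ.sub a b ha hab hb).IsSimple := by
  intro x hx y hy hxy
  have hx1 := hx.1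
  have hx2 : x ≤ b - a := hx.2
  have hy1 := hy.1
  have hy2 : y ≤ b - a := hy.2
  have := h (x₁ := x + a) (x₂ := y + a) ⟨by linarith, by linarith⟩ ⟨by linarith, by linarith⟩ hxy
  linarith

/-- Endpoint difference of a curve. -/
noncomputable def MCurve.df {X : Type*} [MetricSpace X] (v : X → ℝ) (γ : MCurve X) : ENNReal :=
  ENNReal.ofReal |v (γ.toFun γ.len) - v (γ.toFun 0)|

lemma le_pVar {X : Type*} [MetricSpace X] (v : X → ℝ) {ι : Type} [Fintype ι]
    (γ : ι → MCurve X) (hs : ∀ i, (γ i).IsSimple)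
    (hd : ∀ i j, i ≠ j → Disjoint (γ i).image (γ j).image) :
    ∑ i, (γ i).df v ≤ pVar v := by
  let e := Fintype.equivFin ι
  have : ∑ i, (γ i).df v = ∑ k, (γ (e.symm k)).df v := (Equiv.sum_comp e.symm _).symm
  rw [this]
  unfold pVar
  refine le_iSup_of_le (Fintype.card ι) (le_iSup_of_le (fun k => γ (e.symm k))
    (le_iSup_of_le (fun i => hs _) (le_iSup_of_le (fun i j hij => hd _ _ ?_) le_rfl)))
  exact fun h => hij (e.symm.injective h)

lemma sub_family {X : Type*} [MetricSpace X] (w : X → ℝ) (hw : CurveContinuous w) (t : ℝ)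
    {ε : ℝ} (hε : 0 < ε) (n : ℕ) (γ : Fin n → MCurve X) (hs : ∀ i, (γ i).IsSimple)
    (hd : ∀ i j, i ≠ j → Disjoint (γ i).image (γ j).image) :
    ∃ (p : Fin n → Prop) (η : {i // p i} → MCurve X), (∀ i, (η i).IsSimple) ∧
      (∀ i j, i ≠ j → Disjoint (η i).image (η j).image) ∧
      (∀ i, (η i).image ⊆ {x | w x < t}) ∧
      ∀ [Fintype {i // p i}], ∑ i, (γ i).df (fun x => min t (w x)) ≤
        ∑ i, (η i).df w + n * ENNReal.ofReal ε := by
  classical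
  let p : Fin n → Prop := fun i => (γ i).df (fun x => min t (w x)) ≠ 0
  have key : ∀ i : {i // p i}, ∃ η : MCurve X, η.IsSimple ∧ η.image ⊆ (γ i).image ∧
      η.image ⊆ {x | w x < t} ∧
      (γ i).df (fun x => min t (w x)) ≤ η.df w + ENNReal.ofReal ε := by
    rintro ⟨i, hi⟩
    obtain ⟨a, b, ha, hab, hb, hlt, hle⟩ := aux_trim (t := t) (γ i).len_nonneg (hw (γ i)) hε
      (by
        intro h
        apply hi
        simp only [Function.comp] at h
        simp [MCurve.df, h])
    refine ⟨(γ i).sub a b ha hab hb, (γ i).sub_simple _ _ _ _ _ (hs i), ?_, ?_, ?_⟩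
    · rw [MCurve.sub_image]
      exact Set.image_mono (Set.Icc_subset_Icc ha hb)
    · rw [MCurve.sub_image]
      rintro _ ⟨x, hx, rfl⟩
      exact hlt x hx
    · unfold MCurve.df
      rw [← ENNReal.ofReal_add (abs_nonneg _) hε.le]
      apply ENNReal.ofReal_le_ofReal
      simpa [MCurve.sub] using hle
  choose η h1 h2 h3 h4 using key
  refine ⟨p, η, h1, ?_, h3, ?_⟩
  · intro i j hij
    exact (hd i j (fun h => hij (Subtype.ext h))).mono (h2 i) (h2 j)
  · intro inst
    have e1 : ∑ i, (γ i).df (fun x => min t (w x)) =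
        ∑ i : {i // p i}, (γ i).df (fun x => min t (w x)) := by
      rw [← Finset.sum_filter_ne_zero]
      apply Finset.sum_subtype
      intro x
      simp [p]
    rw [e1]
    calc _ ≤ ∑ i : {i // p i}, ((η i).df w + ENNReal.ofReal ε) := Finset.sum_le_sum (fun i _ => h4 i)
      _ = ∑ i, (η i).df w + (Fintype.card {i // p i}) * ENNReal.ofReal ε := by
        rw [Finset.sum_add_distrib]; simp
      _ ≤ _ := by
        gcongr
        simpa using Fintype.card_subtype_le p

lemma two_families {X : Type*} [MetricSpace X] (w : X → ℝ) (hw : CurveContinuous w) (t : ℝ)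
    (n : ℕ) (γ : Fin n → MCurve X) (hs : ∀ i, (γ i).IsSimple)
    (hd : ∀ i j, i ≠ j → Disjoint (γ i).image (γ j).image)
    (m : ℕ) (σ : Fin m → MCurve X) (hs' : ∀ i, (σ i).IsSimple)
    (hd' : ∀ i j, i ≠ j → Disjoint (σ i).image (σ j).image) :
    ∑ i, (γ i).df (fun x => min t (w x)) + ∑ i, (σ i).df (fun x => max t (w x)) ≤ pVar w := by
  classical
  have hstep : ∀ ε : ℝ, 0 < ε →
      ∑ i, (γ i).df (fun x => min t (w x)) + ∑ i, (σ i).df (fun x => max t (w x)) ≤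
        pVar w + ((n : ENNReal) + m) * ENNReal.ofReal ε := by
    intro ε hε
    obtain ⟨p, η, a1, a2, a3, a4⟩ := sub_family w hw t hε n γ hs hd
    obtain ⟨q, θ, b1, b2, b3, b4⟩ := sub_family (fun x => - w x) (fun c => (hw c).neg) (-t) hε m σ hs' hd'
    have e1 : ∀ c : MCurve X, c.df (fun x => min (-t) (-w x)) = c.df (fun x => max t (w x)) := by
      intro c
      simp only [MCurve.df, min_neg_neg]
      rw [← abs_neg]; congr 2; ring
    have e2 : ∀ c : MCurve X, c.df (fun x => -w x) = c.df w := by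
      intro c
      simp only [MCurve.df]
      rw [← abs_neg]; congr 2; ring
    simp only [e1, e2] at b4
    have hdis : ∀ i j, Disjoint (η i).image (θ j).image := by
      intro i j
      rw [Set.disjoint_left]
      intro x hx hx'
      have u := a3 i hx
      have u' := b3 j hx'
      simp only [Set.mem_setOf_eq] at u u'
      linarith
    have hp := le_pVar w (Sum.elim η θ) (by rintro (i | i); exacts [a1 i, b1 i]) (by
      rintro (i | i) (j | j) hij
      · exact a2 i j (fun h => hij (by rw [h]))
      · exact hdis i j
      · exact (hdis j i).symm
      · exact b2 i j (fun h => hij (by rw [h])))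
    rw [Fintype.sum_sum_type] at hp
    simp only [Sum.elim_inl, Sum.elim_inr] at hp
    calc _ ≤ (∑ i, (η i).df w + n * ENNReal.ofReal ε) + (∑ i, (θ i).df w + m * ENNReal.ofReal ε) :=
          add_le_add a4 b4
      _ = (∑ i, (η i).df w + ∑ i, (θ i).df w) + ((n : ENNReal) + m) * ENNReal.ofReal ε := by ring
      _ ≤ _ := by gcongr
  apply ENNReal.le_of_forall_pos_le_add
  intro δ hδ _
  have hpos : (0 : ℝ) < (n : ℝ) + m + 1 := by positivity
  refine (hstep (δ / (n + m + 1)) (by positivity)).trans ?_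
  gcongr
  have : ((n : ENNReal) + m) = ENNReal.ofReal ((n : ℝ) + m) := by
    rw [ENNReal.ofReal_add (by positivity) (by positivity)]; simp
  rw [this, ← ENNReal.ofReal_mul (by positivity), ← ENNReal.ofReal_coe_nnreal]
  apply ENNReal.ofReal_le_ofReal
  rw [mul_div_assoc', div_le_iff₀ hpos]
  nlinarith [δ.2, show (0 : ℝ) < δ from hδ]

lemma pVar_eq {X : Type*} [MetricSpace X] (v : X → ℝ) : pVar v =
    ⨆ F : {F : (n : ℕ) × (Fin n → MCurve X) // (∀ i, (F.2 i).IsSimple) ∧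
      ∀ i j, i ≠ j → Disjoint (F.2 i).image (F.2 j).image}, ∑ i, (F.1.2 i).df v := by
  apply le_antisymm
  · unfold pVar
    refine iSup_le fun n => iSup_le fun γ => iSup_le fun h1 => iSup_le fun h2 => ?_
    exact le_iSup_of_le ⟨⟨n, γ⟩, h1, h2⟩ le_rfl
  · exact iSup_le fun F => le_pVar v F.1.2 F.2.1 F.2.2

theorem stmt11 {X : Type*} [MetricSpace X] [CompleteSpace X] [ConnectedSpace X]
    [MeasurableSpace X] [BorelSpace X]
    (h0 : 0 < μH[1] (Set.univ : Set X)) (h1 : μH[1] (Set.univ : Set X) < ⊤)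
    (v : X → ℝ) (hvc : CurveContinuous v) (hv : pVar v < ⊤)
    (t r : ℝ) (hr : 0 < r) :
    pVar (fun x => min t (v x)) + pVar (fun x => max t (min (t + r) (v x)))
      ≤ pVar (fun x => min (t + r) (v x)) := by
  have hw : CurveContinuous (fun x => min (t + r) (v x)) := fun c =>
    continuousOn_const.inf (hvc c)
  have e : (fun x => min t (v x)) = fun x => min t (min (t + r) (v x)) := by
    funext x
    rw [← min_assoc, min_eq_left (by linarith : t ≤ t + r)]
  rw [e, pVar_eq (fun x => min t (min (t + r) (v x))),
    pVar_eq (fun x => max t (min (t + r) (v x)))]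
  haveI : Nonempty {F : (n : ℕ) × (Fin n → MCurve X) // (∀ i, (F.2 i).IsSimple) ∧
      ∀ i j, i ≠ j → Disjoint (F.2 i).image (F.2 j).image} :=
    ⟨⟨⟨0, Fin.elim0⟩, fun i => i.elim0, fun i => i.elim0⟩⟩
  apply ENNReal.iSup_add_iSup_le
  intro F G
  exact two_families _ hw t _ _ F.2.1 F.2.2 _ _ G.2.1 G.2.2
end

section
/- Let (X,d) be a complete and connected metric space with 0 < ℋ¹(X) < ∞. Let v : X → ℝ be curve-continuous and t ∈ ℝ. Then pV(χ_{{v>t}},X) ≤ liminf_{r→0⁺} (1/r)·pV(v_{t,t+r},X), where v_{t,t+r} := max{t, min{t+r,v}} and χ_{{v>t}} is the characteristic function of {x ∈ X : v(x) > t}. -/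
open MeasureTheory Set Filter Topology ENNReal

theorem stmt12_pt (a b t : ℝ) (ca cb : ℝ) (hca : ca = if t < a then 1 else 0)
    (hcb : cb = if t < b then 1 else 0) :
    ∀ᶠ r : ℝ in 𝓝[>] 0, ENNReal.ofReal |ca - cb| ≤
      (ENNReal.ofReal r)⁻¹ * ENNReal.ofReal |max t (min (t + r) a) - max t (min (t + r) b)| := by
  have key : ∀ c : ℝ, t < c → ∀ᶠ r : ℝ in 𝓝[>] 0, max t (min (t + r) c) = t + r := by
    intro c hc
    filter_upwards [Ioo_mem_nhdsGT (sub_pos.2 hc)] with r hr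
    rw [min_eq_left (by linarith [hr.2]), max_eq_right (by linarith [hr.1])]
  have low : ∀ c r : ℝ, ¬ t < c → max t (min (t + r) c) = t := by
    intro c r hc
    exact max_eq_left ((min_le_right _ _).trans (not_lt.1 hc))
  have fin : ∀ r : ℝ, 0 < r → (1 : ℝ≥0∞) ≤ (ENNReal.ofReal r)⁻¹ * ENNReal.ofReal r := by
    intro r hr
    rw [ENNReal.inv_mul_cancel (by simpa using hr) ENNReal.ofReal_ne_top]
  by_cases ha : t < a <;> by_cases hb : t < b
  · simp [hca, hcb, ha, hb]
  · filter_upwards [key a ha, self_mem_nhdsWithin] with r h hr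
    have hr' : 0 < r := hr
    rw [h, low b r hb]
    simpa [hca, hcb, ha, hb, abs_of_pos hr'] using fin r hr'
  · filter_upwards [key b hb, self_mem_nhdsWithin] with r h hr
    have hr' : 0 < r := hr
    rw [h, low a r ha]
    simpa [hca, hcb, ha, hb, abs_of_pos hr'] using fin r hr'
  · simp [hca, hcb, ha, hb]

theorem stmt12 {X : Type*} [MetricSpace X] [CompleteSpace X] [ConnectedSpace X]
    [MeasurableSpace X] [BorelSpace X]
    (h0 : 0 < μH[1] (Set.univ : Set X)) (h1 : μH[1] (Set.univ : Set X) < ⊤)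
    (v : X → ℝ) (hvc : CurveContinuous v) (t : ℝ) :
    pVar (Set.indicator {x : X | t < v x} (fun _ => (1 : ℝ)))
      ≤ Filter.liminf
          (fun r : ℝ => (ENNReal.ofReal r)⁻¹ * pVar (fun x => max t (min (t + r) (v x))))
          (𝓝[>] 0) := by
  classical
  refine iSup_le fun n => iSup_le fun γ => iSup_le fun hs => iSup_le fun hd => ?_
  refine le_liminf_of_le (by isBoundedDefault) ?_
  have H := eventually_all.2 fun i : Fin n =>
    stmt12_pt (v ((γ i).toFun (γ i).len)) (v ((γ i).toFun 0)) t
      (Set.indicator {x : X | t < v x} (fun _ => (1 : ℝ)) ((γ i).toFun (γ i).len))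
      (Set.indicator {x : X | t < v x} (fun _ => (1 : ℝ)) ((γ i).toFun 0))
      (by simp [Set.indicator_apply]) (by simp [Set.indicator_apply])
  filter_upwards [H] with r hr
  refine (Finset.sum_le_sum fun i _ => hr i).trans ?_
  rw [← Finset.mul_sum]
  gcongr
  exact le_iSup_of_le n (le_iSup_of_le γ (le_iSup_of_le hs (le_iSup_of_le hd le_rfl)))
end
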